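/- Let (Ω, 𝓕, P) be a probability space, let X_t, X_1 : Ω → ℕ be integrable random variables with E[X_t] ≠ 0, and let (U_j)_{j∈ℕ} be identically distributed integrable real random variables with common mean μ, with the family (U_j) independent of the pair (X_t, X_1). Define Y_t = Σ_{j=1}^{X_t} U_j and Y_1 = Σ_{j=1}^{X_1} U_j. Then E[Y_1]·E[X_t] = E[X_1]·E[Y_t]; equivalently, E[Y_1] = (E[Y_t]/E[X_t])·E[X_1], so scaling the observed sum by the ratio of final to current expected cardinality recovers the expected final sum. -/

import Mathlib

open MeasureTheory ProbabilityTheory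

/-- The expectation of a natural-number-valued random variable is the sum of its tails. -/
theorem hasSum_measureReal_lt_integral {Ω : Type*} [MeasurableSpace Ω] {P : Measure Ω}
    {N : Ω → ℕ} (hN : Measurable N) (hNint : Integrable (fun ω => (N ω : ℝ)) P) :
    HasSum (fun j : ℕ => P.real {ω | j < N ω}) (∫ ω, (N ω : ℝ) ∂P) := by
  have hset (j : ℕ) : MeasurableSet {ω | j < N ω} := hN measurableSet_Ioi
  have htail : ∑' j : ℕ, P {ω | j < N ω} = ∫⁻ ω, (N ω : ENNReal) ∂P := by
    have hcount (ω : Ω) :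
        (N ω : ENNReal) = ∑' j : ℕ, {ω | j < N ω}.indicator (fun _ => (1 : ENNReal)) ω := by
      rw [tsum_eq_sum (s := Finset.range (N ω)) (fun j hj => by simpa using hj)]
      rw [Finset.sum_congr rfl (g := fun _ => (1 : ENNReal))
        (fun j hj => by simpa using hj)]
      simp
    simp_rw [hcount]
    rw [lintegral_tsum fun j => (measurable_const.indicator (hset j)).aemeasurable]
    simp [lintegral_indicator, hset]
  have hmean : ∫ ω, (N ω : ℝ) ∂P = (∫⁻ ω, (N ω : ENNReal) ∂P).toReal := by
    rw [integral_eq_lintegral_of_nonneg_ae (ae_of_all _ fun ω => Nat.cast_nonneg _)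
      hNint.aestronglyMeasurable]
    simp
  have hfin : ∑' j : ℕ, P {ω | j < N ω} ≠ ⊤ := by
    have h := hNint.lintegral_lt_top.ne
    simpa [htail] using h
  rw [hmean, ← htail, ENNReal.tsum_toReal_eq (ENNReal.ne_top_of_tsum_ne_top hfin)]
  exact (ENNReal.summable_toReal hfin).hasSum

/-- **Wald's identity** for a random number of terms, each independent of that number. -/
theorem integral_sum_range_eq_integral_mul {Ω : Type*} [MeasurableSpace Ω] {P : Measure Ω}
    {N : Ω → ℕ} (hN : Measurable N) (hNint : Integrable (fun ω => (N ω : ℝ)) P)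
    {U : ℕ → Ω → ℝ} (hUint : ∀ j, Integrable (U j) P) {μ c : ℝ}
    (hUmean : ∀ j, ∫ ω, U j ω ∂P = μ) (hUnorm : ∀ j, ∫ ω, ‖U j ω‖ ∂P = c)
    (hindep : ∀ j, IndepFun N (U j) P) :
    ∫ ω, ∑ j ∈ Finset.range (N ω), U j ω ∂P = (∫ ω, (N ω : ℝ) ∂P) * μ := by
  have hset (j : ℕ) : MeasurableSet {ω | j < N ω} := hN measurableSet_Ioi
  have htail := hasSum_measureReal_lt_integral hN hNint
  have hprod (j : ℕ) {g : ℝ → ℝ} (hg : Measurable g) :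
      ∫ ω, {ω | j < N ω}.indicator (fun ω => g (U j ω)) ω ∂P =
        P.real {ω | j < N ω} * ∫ ω, g (U j ω) ∂P := by
    have hi : IndepFun (fun ω => (Set.Ioi j).indicator (fun _ => (1 : ℝ)) (N ω))
        (fun ω => g (U j ω)) P :=
      (hindep j).comp (measurable_const.indicator measurableSet_Ioi) hg
    have h := hi.integral_fun_mul_eq_mul_integral
      ((measurable_const.indicator measurableSet_Ioi).comp hN).aestronglyMeasurable
      (hg.comp_aemeasurable (hUint j).aemeasurable).aestronglyMeasurable
    have hone : ∫ ω, (Set.Ioi j).indicator (fun _ => (1 : ℝ)) (N ω) ∂P =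
        P.real {ω | j < N ω} := integral_indicator_one (hset j)
    rw [← hone, ← h]
    congr 1 with ω
    by_cases hj : j < N ω <;> simp [hj]
  have hsummable : Summable fun j : ℕ =>
      ∫ ω, ‖{ω | j < N ω}.indicator (U j) ω‖ ∂P := by
    simp_rw [norm_indicator_eq_indicator_norm, hprod _ measurable_norm, hUnorm]
    exact htail.summable.mul_right c
  have hsum := hasSum_integral_of_summable_integral_norm
    (fun j => (hUint j).indicator (hset j)) hsummable
  have hterm (j : ℕ) : ∫ ω, {ω | j < N ω}.indicator (U j) ω ∂P =
      P.real {ω | j < N ω} * μ := (hprod j measurable_id).trans (by simp [hUmean])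
  simp_rw [hterm] at hsum
  rw [(htail.mul_right μ).unique hsum]
  congr 1 with ω
  rw [tsum_eq_sum (s := Finset.range (N ω))
    (fun j hj => Set.indicator_of_notMem (by simpa using hj) _)]
  exact Finset.sum_congr rfl fun j hj =>
    (Set.indicator_of_mem (s := {ω | j < N ω}) (Finset.mem_range.mp hj) _).symm

/-- Unconditional correctness of the summation estimator `f_sum`: with compound
sums `Yt = ∑_{j < Xt} U j` and `Y1 = ∑_{j < X1} U j` of identically distributed
mean-`μ` terms independent of the pair `(Xt, X1)`, one has
`E[Y1] * E[Xt] = E[X1] * E[Yt]`, i.e. `E[Y1] = (E[Yt] / E[Xt]) * E[X1]`. -/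
theorem sum_estimator_unbiased {Ω : Type*} [MeasurableSpace Ω]
    (P : Measure Ω) [IsProbabilityMeasure P]
    (Xt X1 : Ω → ℕ) (hXtmeas : Measurable Xt) (hX1meas : Measurable X1)
    (hXtint : Integrable (fun ω => (Xt ω : ℝ)) P)
    (hX1int : Integrable (fun ω => (X1 ω : ℝ)) P)
    (hXtne : ∫ ω, (Xt ω : ℝ) ∂P ≠ 0)
    (U : ℕ → Ω → ℝ) (hUmeas : ∀ j, Measurable (U j))
    (hUint : ∀ j, Integrable (U j) P)
    (μ : ℝ) (hUid : ∀ j, IdentDistrib (U j) (U 0) P P)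
    (hUmean : ∀ j, ∫ ω, U j ω ∂P = μ)
    (hindep : Indep
      (MeasurableSpace.comap (fun ω => (Xt ω, X1 ω)) inferInstance)
      (⨆ j, MeasurableSpace.comap (U j) inferInstance) P)
    (Yt Y1 : Ω → ℝ)
    (hYt : ∀ ω, Yt ω = ∑ j ∈ Finset.range (Xt ω), U j ω)
    (hY1 : ∀ ω, Y1 ω = ∑ j ∈ Finset.range (X1 ω), U j ω) :
    (∫ ω, Y1 ω ∂P) * (∫ ω, (Xt ω : ℝ) ∂P) =
      (∫ ω, (X1 ω : ℝ) ∂P) * (∫ ω, Yt ω ∂P) := by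
  have hpair (j : ℕ) : IndepFun (fun ω => (Xt ω, X1 ω)) (U j) P :=
    (IndepFun_iff_Indep _ _ _).2 <| indep_of_indep_of_le_right hindep
      (le_iSup (fun j => MeasurableSpace.comap (U j) inferInstance) j)
  have hnorm (j : ℕ) : ∫ ω, ‖U j ω‖ ∂P = ∫ ω, ‖U 0 ω‖ ∂P :=
    ((hUid j).comp measurable_norm).integral_eq
  simp_rw [hYt, hY1]
  rw [integral_sum_range_eq_integral_mul hXtmeas hXtint hUint hUmean hnorm
      fun j => (hpair j).comp measurable_fst measurable_id,
    integral_sum_range_eq_integral_mul hX1meas hX1int hUint hUmean hnorm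
      fun j => (hpair j).comp measurable_snd measurable_id]
  ring
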